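/- arXiv:math/0407376 — 5 statements merged into one kernel-verified Lean document; each statement's English description precedes it below -/
import Mathlib

section
/- If 2 ≤ k and 2k < n, then there exists g ∈ SL_n(ℝ) such that g·Y_{k,1}·g⁻¹ = Y_{k,−1}; that is, the two matrices Y_{k,1} and Y_{k,−1} lie in the same SL_n(ℝ)-conjugation orbit, so O_{k,1} = O_{k,−1}. -/
open Matrix

/-- The n×n real matrix unit `E_{a,b}` (1-based indices). -/
noncomputable def Ematrix (n a b : ℕ) : Matrix (Fin n) (Fin n) ℝ :=
  fun s t => if (s : ℕ) + 1 = a ∧ (t : ℕ) + 1 = b then 1 else 0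

/-- `X_{k,ε} = Σ_{i=1}^{k−1} E_{n+1−i,i} + ε·E_{n+1−k,k}`. -/
noncomputable def Xmat (n k : ℕ) (ε : ℝ) : Matrix (Fin n) (Fin n) ℝ :=
  (∑ i ∈ Finset.Icc 1 (k - 1), Ematrix n (n + 1 - i) i) + ε • Ematrix n (n + 1 - k) k

/-- `Y_{k,ε} = Σ_{i=1}^{k−1} E_{2i−1,2i} + ε·E_{2k−1,2k}`. -/
noncomputable def Ymat (n k : ℕ) (ε : ℝ) : Matrix (Fin n) (Fin n) ℝ :=
  (∑ i ∈ Finset.Icc 1 (k - 1), Ematrix n (2 * i - 1) (2 * i)) + ε • Ematrix n (2 * k - 1) (2 * k)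

/-- The diagonal entries, indexed by `ℕ`, of the reflection in the coordinates `p` and `q`. -/
def signFlip (p q : ℕ) (i : ℕ) : ℝ :=
  (if i = p then -1 else 1) * (if i = q then -1 else 1)

lemma prod_signFlip {n p q : ℕ} (hp : p < n) (hq : q < n) :
    ∏ i : Fin n, signFlip p q i = 1 := by
  rw [Fin.prod_univ_eq_prod_range (signFlip p q) n]
  simp only [signFlip, Finset.prod_mul_distrib, Finset.prod_ite_eq', Finset.mem_range, hp, hq,
    if_true]
  norm_num

lemma diagonal_signFlip_mul_self (n p q : ℕ) :
    (diagonal fun i : Fin n => signFlip p q i) * (diagonal fun i : Fin n => signFlip p q i) = 1 := by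
  rw [diagonal_mul_diagonal, ← diagonal_one]
  congr 1
  funext i
  unfold signFlip
  split_ifs <;> norm_num

lemma diagonal_mul_Ematrix_mul_diagonal (n a b : ℕ) (f : ℕ → ℝ) :
    (diagonal fun i : Fin n => f i) * Ematrix n a b * (diagonal fun i : Fin n => f i) =
      (f (a - 1) * f (b - 1)) • Ematrix n a b := by
  ext s t
  rw [mul_diagonal, diagonal_mul, Matrix.smul_apply, Ematrix, smul_eq_mul]
  split_ifs with h
  · rw [← h.1, ← h.2]
    simp
  · simp

/-- Flipping the sign of row `2k - 1` (and of one coordinate not involved in `Y_{k,ε}`)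
negates `ε`. -/
lemma diagonal_signFlip_conj_Ymat {n k : ℕ} (hk : 1 ≤ k) (hkn : 2 * k < n) (ε : ℝ) :
    (diagonal fun i : Fin n => signFlip (2 * k - 2) (n - 1) i) * Ymat n k ε *
      (diagonal fun i : Fin n => signFlip (2 * k - 2) (n - 1) i) = Ymat n k (-ε) := by
  simp only [Ymat, mul_add, add_mul, Finset.mul_sum, Finset.sum_mul, mul_smul_comm, smul_mul_assoc,
    diagonal_mul_Ematrix_mul_diagonal]
  congr 1
  · refine Finset.sum_congr rfl fun i hi => ?_
    rw [Finset.mem_Icc] at hi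
    have h₁ : signFlip (2 * k - 2) (n - 1) (2 * i - 1 - 1) = 1 := by
      rw [signFlip, if_neg (by omega), if_neg (by omega), one_mul]
    have h₂ : signFlip (2 * k - 2) (n - 1) (2 * i - 1) = 1 := by
      rw [signFlip, if_neg (by omega), if_neg (by omega), one_mul]
    rw [h₁, h₂, one_mul, one_smul]
  · have h₁ : signFlip (2 * k - 2) (n - 1) (2 * k - 1 - 1) = -1 := by
      rw [signFlip, if_pos (by omega), if_neg (by omega), mul_one]
    have h₂ : signFlip (2 * k - 2) (n - 1) (2 * k - 1) = 1 := by
      rw [signFlip, if_neg (by omega), if_neg (by omega), one_mul]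
    rw [h₁, h₂, mul_one, smul_smul, mul_neg_one]

theorem Y_orbits_eq_of_nonmaximal (n : ℕ) (hn : 4 ≤ n) (k : ℕ) (hk : 2 ≤ k)
    (hkn : 2 * k < n) :
    (∃ g : Matrix.SpecialLinearGroup (Fin n) ℝ,
        g.val * Ymat n k 1 * (g⁻¹).val = Ymat n k (-1)) ∧
    {M | ∃ g : Matrix.SpecialLinearGroup (Fin n) ℝ, g.val * Ymat n k 1 * (g⁻¹).val = M} =
      {M | ∃ g : Matrix.SpecialLinearGroup (Fin n) ℝ, g.val * Ymat n k (-1) * (g⁻¹).val = M} := by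
  let g : SpecialLinearGroup (Fin n) ℝ :=
    ⟨diagonal fun i : Fin n => signFlip (2 * k - 2) (n - 1) i, by
      rw [det_diagonal, prod_signFlip (by omega) (by omega)]⟩
  have hgg : g * g = 1 := Subtype.ext (diagonal_signFlip_mul_self n _ _)
  have hinv : g⁻¹ = g := inv_eq_of_mul_eq_one_right hgg
  have hconj (ε : ℝ) : g.val * Ymat n k ε * g.val = Ymat n k (-ε) :=
    diagonal_signFlip_conj_Ymat (by omega) hkn ε
  refine ⟨⟨g, by rw [hinv, hconj]⟩, ?_⟩
  have hsub (ε : ℝ) (h : SpecialLinearGroup (Fin n) ℝ) :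
      (h * g).val * Ymat n k (-ε) * ((h * g)⁻¹).val = h.val * Ymat n k ε * (h⁻¹).val := by
    have := hconj (-ε)
    rw [neg_neg] at this
    rw [_root_.mul_inv_rev, hinv, ← this]
    change (h.val * g.val) * _ * (g.val * (h⁻¹).val) = _
    simp only [mul_assoc]
  ext M
  constructor
  · rintro ⟨h, rfl⟩
    exact ⟨h * g, hsub 1 h⟩
  · rintro ⟨h, rfl⟩
    exact ⟨h * g, by simpa only [neg_neg] using hsub (-1) h⟩
end

section
/- Suppose n = 2p is even with p ≥ 2. Then there exists h ∈ GL_{2p}(ℝ) with h·Y_{p,1}·h⁻¹ = Y_{p,−1}, but there is NO g ∈ SL_{2p}(ℝ) with g·Y_{p,1}·g⁻¹ = Y_{p,−1}; in other words Y_{p,1} and Y_{p,−1} lie in the same GL_{2p}(ℝ)-orbit (the same complex nilpotent orbit) but the two SL_{2p}(ℝ)-orbits O_{p,1} and O_{p,−1} are distinct. -/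
open Matrix

/-- The splitting of `Fin (2 * p)` into even (left) and odd (right) positions. -/
def parityEquiv (p : ℕ) : Fin p ⊕ Fin p ≃ Fin (2 * p) where
  toFun := Sum.elim (fun i => ⟨2 * i, by omega⟩) (fun i => ⟨2 * i + 1, by omega⟩)
  invFun s := if (s : ℕ) % 2 = 0 then Sum.inl ⟨s / 2, by omega⟩ else Sum.inr ⟨s / 2, by omega⟩
  left_inv := by
    rintro (i | i)
    · simp
    · have h : (2 * (i : ℕ) + 1) / 2 = i := by omega
      simp [h, Nat.add_mod]
  right_inv s := by
    by_cases h : (s : ℕ) % 2 = 0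
    · simp only [h, if_true, Sum.elim_inl, Fin.ext_iff]
      omega
    · simp only [h, if_false, Sum.elim_inr, Fin.ext_iff]
      omega

/-- The diagonal entries `1, …, 1, ε`. -/
def lastSign (p : ℕ) (ε : ℝ) (i : Fin p) : ℝ := if (i : ℕ) + 1 = p then ε else 1

theorem prod_lastSign {p : ℕ} (hp : 1 ≤ p) (ε : ℝ) : ∏ i, lastSign p ε i = ε := by
  rw [Finset.prod_eq_single (⟨p - 1, by omega⟩ : Fin p)]
  · exact if_pos (by simp only; omega)
  · intro i _ hi
    refine if_neg fun h => hi (Fin.ext ?_)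
    simp only
    omega
  · simp

theorem Ymat_submatrix_parityEquiv {p : ℕ} (hp : 1 ≤ p) (ε : ℝ) :
    (Ymat (2 * p) p ε).submatrix (parityEquiv p) (parityEquiv p) =
      fromBlocks 0 (diagonal (lastSign p ε)) 0 0 := by
  have entry (s t : Fin (2 * p)) : Ymat (2 * p) p ε s t =
      (∑ k ∈ Finset.Icc 1 (p - 1),
        if (s : ℕ) + 1 = 2 * k - 1 ∧ (t : ℕ) + 1 = 2 * k then (1 : ℝ) else 0) +
      ε * if (s : ℕ) + 1 = 2 * p - 1 ∧ (t : ℕ) + 1 = 2 * p then 1 else 0 := by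
    simp [Ymat, Ematrix, Matrix.add_apply, Matrix.sum_apply]
  have vanish (s t : Fin (2 * p)) (h : ¬ ((s : ℕ) % 2 = 0 ∧ (t : ℕ) = s + 1)) :
      Ymat (2 * p) p ε s t = 0 := by
    rw [entry, Finset.sum_eq_zero, if_neg (by omega)]
    · simp
    · intro k hk
      rw [Finset.mem_Icc] at hk
      exact if_neg (by omega)
  ext (i | i) (j | j)
  · exact vanish _ _ (by simp only [parityEquiv, Equiv.coe_fn_mk, Sum.elim_inl]; omega)
  · by_cases hij : i = j
    · subst hij
      simp only [submatrix_apply, fromBlocks_apply₁₂, diagonal_apply_eq, lastSign, entry,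
        parityEquiv, Equiv.coe_fn_mk, Sum.elim_inl, Sum.elim_inr]
      split_ifs with h1 h2
      · rw [Finset.sum_eq_zero]
        · simp
        · intro k hk
          rw [Finset.mem_Icc] at hk
          exact if_neg (by omega)
      · omega
      · omega
      · rw [Finset.sum_eq_single ((i : ℕ) + 1), if_pos (by omega)]
        · simp
        · intro k hk hki
          exact if_neg (by omega)
        · intro hk
          rw [Finset.mem_Icc] at hk
          omega
    · rw [fromBlocks_apply₁₂, diagonal_apply_ne _ hij]
      refine vanish _ _ fun h => hij (Fin.ext ?_)
      simp only [parityEquiv, Equiv.coe_fn_mk, Sum.elim_inl, Sum.elim_inr] at h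
      omega
  · exact vanish _ _ (by
      simp only [parityEquiv, Equiv.coe_fn_mk, Sum.elim_inl, Sum.elim_inr]; omega)
  · exact vanish _ _ (by simp only [parityEquiv, Equiv.coe_fn_mk, Sum.elim_inr]; omega)

/-- A matrix intertwining the square-zero matrices with upper right blocks `1` and `D`, `D`
invertible, is block upper triangular with diagonal blocks `D * E` and `E`. -/
theorem det_of_mul_fromBlocks_eq {m R : Type*} [Fintype m] [DecidableEq m] [CommRing R]
    {D : Matrix m m R} (hD : IsUnit D.det) {M : Matrix (m ⊕ m) (m ⊕ m) R}
    (h : M * fromBlocks 0 1 0 0 = fromBlocks 0 D 0 0 * M) :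
    M.det = D.det * M.toBlocks₂₂.det ^ 2 := by
  rw [← fromBlocks_toBlocks M, fromBlocks_multiply, fromBlocks_multiply] at h
  simp only [Matrix.mul_zero, Matrix.zero_mul, Matrix.mul_one, add_zero, zero_add,
    fromBlocks_inj] at h
  obtain ⟨hC, hA, -, -⟩ := h
  have hC' : M.toBlocks₂₁ = 0 := by
    rw [← Matrix.nonsing_inv_mul_cancel_left D M.toBlocks₂₁ hD, ← hC, Matrix.mul_zero]
  conv_lhs => rw [← fromBlocks_toBlocks M, hC', det_fromBlocks_zero₂₁, hA, det_mul]
  ring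

theorem diagonal_lastSign_one (p : ℕ) : diagonal (lastSign p 1) = 1 := by
  rw [← diagonal_one]
  congr 1
  ext i
  simp [lastSign]

theorem exists_GL_conj_Ymat {p : ℕ} (hp : 1 ≤ p) :
    ∃ h : GL (Fin (2 * p)) ℝ, h.val * Ymat (2 * p) p 1 * (h⁻¹).val = Ymat (2 * p) p (-1) := by
  set D : Matrix (Fin p) (Fin p) ℝ := diagonal (lastSign p (-1)) with hD
  set e := parityEquiv p
  have hdet : ((fromBlocks D 0 0 1).submatrix e.symm e.symm).det ≠ 0 := by
    rw [det_submatrix_equiv_self, det_fromBlocks_zero₂₁, hD, det_diagonal, prod_lastSign hp]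
    simp
  refine ⟨GeneralLinearGroup.mkOfDetNeZero _ hdet, ?_⟩
  rw [Units.mul_inv_eq_iff_eq_mul]
  apply (reindex e.symm e.symm).injective
  simp only [reindex_apply, Equiv.symm_symm]
  rw [← submatrix_mul_equiv _ _ e e e, ← submatrix_mul_equiv _ _ e e e,
    Ymat_submatrix_parityEquiv hp, Ymat_submatrix_parityEquiv hp, diagonal_lastSign_one]
  change ((fromBlocks D 0 0 1).submatrix e.symm e.symm).submatrix e e * _ =
    _ * ((fromBlocks D 0 0 1).submatrix e.symm e.symm).submatrix e e
  simp [submatrix_submatrix, fromBlocks_multiply, hD]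

theorem not_exists_SL_conj_Ymat {p : ℕ} (hp : 1 ≤ p) :
    ¬ ∃ g : Matrix.SpecialLinearGroup (Fin (2 * p)) ℝ,
      g.val * Ymat (2 * p) p 1 * (g⁻¹).val = Ymat (2 * p) p (-1) := by
  rintro ⟨g, hg⟩
  set e := parityEquiv p
  have hinv : (g⁻¹).val * g.val = 1 := congrArg Subtype.val (inv_mul_cancel g)
  have hcomm : g.val * Ymat (2 * p) p 1 = Ymat (2 * p) p (-1) * g.val := by
    rw [← hg, Matrix.mul_assoc _ _ g.val, hinv, Matrix.mul_one]
  have hsub := congrArg (fun M => M.submatrix e e) hcomm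
  rw [← submatrix_mul_equiv _ _ e e e, ← submatrix_mul_equiv _ _ e e e,
    Ymat_submatrix_parityEquiv hp, Ymat_submatrix_parityEquiv hp, diagonal_lastSign_one] at hsub
  have hD : (diagonal (lastSign p (-1))).det = -1 := by rw [det_diagonal, prod_lastSign hp]
  have hdet := det_of_mul_fromBlocks_eq (by simp [hD]) hsub
  rw [det_submatrix_equiv_self, g.prop, hD] at hdet
  nlinarith [sq_nonneg (g.val.submatrix e e).toBlocks₂₂.det]

theorem maximal_orbits_distinct (p : ℕ) (hp : 2 ≤ p) :
    (∃ h : GL (Fin (2 * p)) ℝ,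
        h.val * Ymat (2 * p) p 1 * (h⁻¹).val = Ymat (2 * p) p (-1)) ∧
    (¬ ∃ g : Matrix.SpecialLinearGroup (Fin (2 * p)) ℝ,
        g.val * Ymat (2 * p) p 1 * (g⁻¹).val = Ymat (2 * p) p (-1)) ∧
    {M | ∃ g : Matrix.SpecialLinearGroup (Fin (2 * p)) ℝ,
        g.val * Ymat (2 * p) p 1 * (g⁻¹).val = M} ≠
      {M | ∃ g : Matrix.SpecialLinearGroup (Fin (2 * p)) ℝ,
        g.val * Ymat (2 * p) p (-1) * (g⁻¹).val = M} := by
  have hSL := not_exists_SL_conj_Ymat (p := p) (by omega)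
  refine ⟨exists_GL_conj_Ymat (by omega), hSL, fun h => hSL ?_⟩
  exact h.symm.subset ⟨1, by simp⟩
end

section
/- Let k be an integer with 2 ≤ k and 2k < n. If N and N′ are real n×n matrices with N² = 0, N′² = 0 and rank N = rank N′ = k, then there exists g ∈ SL_n(ℝ) with g·N·g⁻¹ = N′. (Thus for k < n/2 the intersection of the complex nilpotent orbit of Jordan type (2^k,1^{n−2k}) with sl_n(ℝ) consists of a single SL_n(ℝ)-orbit.) -/
open Matrix

section SquareZero

variable {K V : Type*} [Field K] [AddCommGroup V] [Module K V] [FiniteDimensional K V]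

/-- A square-zero endomorphism of rank `k` has a Jordan basis: `k` chains of length two together
with `m` further kernel vectors. -/
theorem exists_basis_of_comp_self_eq_zero (f : V →ₗ[K] V) (hf : ∀ v, f (f v) = 0) {k m : ℕ}
    (hr : Module.finrank K f.range = k) (hn : Module.finrank K V = k + (k + m)) :
    ∃ b : Module.Basis (Fin k ⊕ (Fin k ⊕ Fin m)) K V,
      (∀ i, f (b (.inl i)) = b (.inr (.inl i))) ∧ ∀ j, f (b (.inr j)) = 0 := by
  obtain ⟨C, hC⟩ := Submodule.exists_isCompl f.ker
  have hle : f.range ≤ f.ker := by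
    rintro _ ⟨v, rfl⟩
    exact hf v
  obtain ⟨W, hWle, hW⟩ : ∃ W ≤ f.ker, f.range ⊔ W = f.ker ∧ Disjoint f.range W := by
    obtain ⟨W, hW⟩ := Submodule.exists_isCompl f.range
    refine ⟨W ⊓ f.ker, inf_le_right, ?_, hW.disjoint.mono_right inf_le_left⟩
    rw [← sup_inf_assoc_of_le W hle, hW.sup_eq_top, top_inf_eq]
  have hrn := f.finrank_range_add_finrank_ker
  have hCk : Module.finrank K C = k := by
    have := Submodule.finrank_add_eq_of_isCompl hC
    omega
  have hWm : Module.finrank K W = m := by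
    have := Submodule.finrank_sup_add_finrank_inf_eq f.range W
    rw [hW.1, hW.2.eq_bot, finrank_bot] at this
    omega
  let c := Module.finBasisOfFinrankEq K C hCk
  let w := Module.finBasisOfFinrankEq K W hWm
  have hcspan : Submodule.span K (Set.range fun i ↦ (c i : V)) = C := by
    have := congrArg (Submodule.map C.subtype) c.span_eq
    rwa [Submodule.map_span, ← Set.range_comp, Submodule.map_subtype_top] at this
  have hc : LinearIndependent K fun i ↦ (c i : V) :=
    c.linearIndependent.map' C.subtype C.ker_subtype
  have hw : LinearIndependent K fun i ↦ (w i : V) :=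
    w.linearIndependent.map' W.subtype W.ker_subtype
  have hfc : LinearIndependent K fun i ↦ f (c i) :=
    hc.map (by rw [hcspan]; exact hC.disjoint.symm)
  have hkernel : LinearIndependent K (Sum.elim (fun i ↦ f (c i)) fun j ↦ (w j : V)) := by
    refine hfc.sum_type hw (hW.2.mono ?_ ?_) <;> rw [Submodule.span_le]
    · rintro _ ⟨i, rfl⟩
      exact ⟨_, rfl⟩
    · rintro _ ⟨i, rfl⟩
      exact (w i).2
  have hmem : ∀ j, Sum.elim (fun i ↦ f (c i)) (fun j ↦ (w j : V)) j ∈ f.ker := by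
    rintro (i | j)
    · exact hf _
    · exact hWle (w j).2
  have hli := hc.sum_type hkernel (by
    rw [hcspan]
    refine hC.disjoint.symm.mono_right ?_
    rw [Submodule.span_le]
    rintro _ ⟨j, rfl⟩
    exact hmem j)
  let b := basisOfLinearIndependentOfCardEqFinrank' _ hli (by simp [hn])
  refine ⟨b, fun i ↦ ?_, fun j ↦ ?_⟩
  · simp [b]
  · simpa [b] using hmem j

/-- Two square-zero endomorphisms of the same rank with `2 * rank < dim` are intertwined by an
endomorphism of determinant one. -/
theorem exists_det_eq_one_comp_eq (f f' : V →ₗ[K] V) (hf : ∀ v, f (f v) = 0)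
    (hf' : ∀ v, f' (f' v) = 0) {k : ℕ} (hr : Module.finrank K f.range = k)
    (hr' : Module.finrank K f'.range = k) (hk : 2 * k < Module.finrank K V) :
    ∃ g : V →ₗ[K] V, LinearMap.det g = 1 ∧ g ∘ₗ f = f' ∘ₗ g := by
  obtain ⟨m, hm⟩ : ∃ m, Module.finrank K V = k + (k + (m + 1)) :=
    ⟨Module.finrank K V - (2 * k + 1), by omega⟩
  obtain ⟨b, hb, hb₀⟩ := exists_basis_of_comp_self_eq_zero f hf hr hm
  obtain ⟨b', hb', hb₀'⟩ := exists_basis_of_comp_self_eq_zero f' hf' hr' hm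
  let e := b.equiv b' (Equiv.refl _)
  let t : Kˣ := (LinearEquiv.det e)⁻¹
  let u : Fin k ⊕ (Fin k ⊕ Fin (m + 1)) → Kˣ :=
    Sum.elim 1 (Sum.elim 1 (Pi.mulSingle 0 t))
  let s := b.equiv (b.unitsSMul u) (Equiv.refl _)
  have hs : ∀ i, s (b i) = u i • b i := fun i ↦ by simp [s, Module.Basis.unitsSMul_apply]
  have he : ∀ i, e (b i) = b' i := fun i ↦ by simp [e]
  have hdet : LinearMap.det (s : V →ₗ[K] V) = t := by
    have h := b.det_comp (s : V →ₗ[K] V) b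
    have hsb : (s : V →ₗ[K] V) ∘ b = b.unitsSMul u := by
      ext i
      simp [s]
    rw [hsb, Module.Basis.det_unitsSMul_self, b.det_self, mul_one] at h
    rw [← h]
    simp [u, ← Units.coe_prod]
  refine ⟨(e : V →ₗ[K] V) ∘ₗ s, ?_, b.ext ?_⟩
  · rw [LinearMap.det_comp, hdet, ← LinearEquiv.coe_det, ← Units.val_mul, mul_inv_cancel,
      Units.val_one]
  · rintro (i | j)
    · simp [hs, he, hb, hb', u]
    · simp [hs, he, hb₀, hb₀', Units.smul_def]

end SquareZero

theorem sl_conj_of_squareZero_rank_eq (n : ℕ) (hn : 4 ≤ n) (k : ℕ) (hk : 2 ≤ k)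
    (hkn : 2 * k < n) (N N' : Matrix (Fin n) (Fin n) ℝ)
    (hN : N * N = 0) (hN' : N' * N' = 0) (hrN : N.rank = k) (hrN' : N'.rank = k) :
    ∃ g : Matrix.SpecialLinearGroup (Fin n) ℝ, g.val * N * (g⁻¹).val = N' := by
  obtain ⟨g, hg, hcomm⟩ := exists_det_eq_one_comp_eq N.toLin' N'.toLin'
    (fun v ↦ by simp [hN]) (fun v ↦ by simp [hN']) hrN hrN' (by simpa using hkn)
  let G : Matrix.SpecialLinearGroup (Fin n) ℝ :=
    ⟨LinearMap.toMatrix' g, by rw [LinearMap.det_toMatrix', hg]⟩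
  have hG : G.val * N = N' * G.val := by
    simpa [LinearMap.toMatrix'_comp] using congrArg LinearMap.toMatrix' hcomm
  refine ⟨G, ?_⟩
  rw [hG, mul_assoc, ← Matrix.SpecialLinearGroup.coe_mul, mul_inv_cancel,
    Matrix.SpecialLinearGroup.coe_one, mul_one]
end

section
/- For every integer k with 2 ≤ k and 2k ≤ n and every sign ε ∈ {1,−1}, the centralizer of X_{k,ε} in the Borel subalgebra, i.e. the real subspace { Y ∈ 𝔟 : X_{k,ε}·Y = Y·X_{k,ε} }, has dimension d with 2d = (n−2k−1)(n−2k+2) + 2k; consequently dim 𝔟 − d = 2k(n−k). -/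
open Matrix

/-- The Borel subalgebra `𝔟` of upper-triangular traceless real n×n matrices,
as a real subspace. -/
def borelSl (n : ℕ) : Submodule ℝ (Matrix (Fin n) (Fin n) ℝ) where
  carrier := {Y | Y.trace = 0 ∧ ∀ s t : Fin n, (t : ℕ) < (s : ℕ) → Y s t = 0}
  add_mem' := by
    rintro a b ⟨ha1, ha2⟩ ⟨hb1, hb2⟩
    exact ⟨by simp [Matrix.trace_add, ha1, hb1],
      fun s t h => by simp [Matrix.add_apply, ha2 s t h, hb2 s t h]⟩
  zero_mem' := ⟨by simp, fun s t _ => rfl⟩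
  smul_mem' := by
    rintro c Y ⟨h1, h2⟩
    exact ⟨by simp [Matrix.trace_smul, h1],
      fun s t h => by simp [Matrix.smul_apply, h2 s t h]⟩

/-- The subspace of matrices commuting with `X`. -/
def commWith (n : ℕ) (X : Matrix (Fin n) (Fin n) ℝ) :
    Submodule ℝ (Matrix (Fin n) (Fin n) ℝ) where
  carrier := {Y | X * Y = Y * X}
  add_mem' := by
    intro a b ha hb
    simp only [Set.mem_setOf_eq] at *
    simp [Matrix.mul_add, Matrix.add_mul, ha, hb]
  zero_mem' := by simp
  smul_mem' := by
    intro c Y h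
    simp only [Set.mem_setOf_eq] at *
    simp [Matrix.mul_smul, Matrix.smul_mul, h]

/-- The trace-zero part of the range of an injective linear parametrization by `ι → ℝ`
has codimension one as soon as the trace does not vanish on it. -/
lemma finrank_add_one_of_parametrization {n : ℕ} {ι : Type} [Fintype ι]
    (φ : (ι → ℝ) →ₗ[ℝ] Matrix (Fin n) (Fin n) ℝ) (hinj : Function.Injective φ)
    (htr : ∃ f, (φ f).trace ≠ 0) (W : Submodule ℝ (Matrix (Fin n) (Fin n) ℝ))
    (hW : ∀ Y, Y ∈ W ↔ Y.trace = 0 ∧ ∃ f, φ f = Y) :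
    Module.finrank ℝ W + 1 = Fintype.card ι := by
  let τ : Module.Dual ℝ (ι → ℝ) := (Matrix.traceLinearMap (Fin n) ℝ ℝ).comp φ
  have hτ : τ ≠ 0 := by
    obtain ⟨f, hf⟩ := htr
    intro h
    exact hf (LinearMap.congr_fun h f)
  have hmap : W = (LinearMap.ker τ).map φ := by
    ext Y
    rw [hW, Submodule.mem_map]
    constructor
    · rintro ⟨h, f, rfl⟩
      exact ⟨f, h, rfl⟩
    · rintro ⟨f, h, rfl⟩
      exact ⟨h, f, rfl⟩
  rw [hmap, ← (Submodule.equivMapOfInjective φ hinj (LinearMap.ker τ)).finrank_eq,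
    Module.Dual.finrank_ker_add_one_of_ne_zero hτ, Module.finrank_fintype_fun_eq_card]

/-- Positions on or above the diagonal of an `m × m` matrix, as pairs (column, row). -/
abbrev UpperIndex (m : ℕ) : Type := Σ j : Fin m, Fin ((j : ℕ) + 1)

lemma two_mul_card_upperIndex (m : ℕ) :
    2 * Fintype.card (UpperIndex m) = m * (m + 1) := by
  simp only [Fintype.card_sigma, Fintype.card_fin]
  rw [Fin.sum_univ_eq_sum_range (fun i => i + 1) m]
  induction m with
  | zero => simp
  | succ m ih => rw [Finset.sum_range_succ, mul_add, ih]; ring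

/-- The upper-triangular matrix with prescribed entries on and above the diagonal. -/
def upperOfEntries (n : ℕ) : (UpperIndex n → ℝ) →ₗ[ℝ] Matrix (Fin n) (Fin n) ℝ where
  toFun f := Matrix.of fun s t => if h : (s : ℕ) ≤ t then f ⟨t, ⟨s, Nat.lt_succ_of_le h⟩⟩ else 0
  map_add' f g := by
    ext s t
    simp only [Matrix.of_apply, Matrix.add_apply, Pi.add_apply]
    split_ifs <;> simp
  map_smul' c f := by
    ext s t
    simp only [Matrix.of_apply, Matrix.smul_apply, Pi.smul_apply, RingHom.id_apply]
    split_ifs <;> simp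

lemma upperOfEntries_apply (n : ℕ) (f : UpperIndex n → ℝ) (s t : Fin n) :
    upperOfEntries n f s t =
      if h : (s : ℕ) ≤ t then f ⟨t, ⟨s, Nat.lt_succ_of_le h⟩⟩ else 0 := rfl

lemma finrank_borelSl_add_one {n : ℕ} (hn : n ≠ 0) :
    Module.finrank ℝ (borelSl n) + 1 = Fintype.card (UpperIndex n) := by
  refine finrank_add_one_of_parametrization (upperOfEntries n) ?_ ⟨1, ?_⟩ _ ?_
  · intro f g h
    ext ⟨j, i⟩
    have hi := i.2
    have := congrFun (congrFun h ⟨i, by omega⟩) j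
    simpa [upperOfEntries_apply, Nat.le_of_lt_succ hi] using this
  · simpa [Matrix.trace, upperOfEntries_apply] using hn
  · intro Y
    refine and_congr_right fun _ => ⟨fun h => ?_, ?_⟩
    · refine ⟨fun p => Y ⟨p.2, by omega⟩ p.1, ?_⟩
      ext s t
      rw [upperOfEntries_apply]
      split_ifs with hst
      · rfl
      · exact (h s t (by omega)).symm
    · rintro ⟨f, rfl⟩ s t hst
      rw [upperOfEntries_apply, dif_neg (by omega)]

lemma Xmat_apply {n k : ℕ} (hk : 1 ≤ k) (ε : ℝ) (s t : Fin n) :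
    Xmat n k ε s t = if t = Fin.rev s then
      (if (t : ℕ) < k then (if (t : ℕ) + 1 = k then ε else 1) else 0) else 0 := by
  have hs := s.2
  have ht := t.2
  have hsum : (∑ i ∈ Finset.Icc 1 (k - 1), Ematrix n (n + 1 - i) i) s t =
      if t = Fin.rev s ∧ (t : ℕ) + 1 < k then 1 else 0 := by
    rw [Matrix.sum_apply]
    simp only [Ematrix]
    split_ifs with h
    · obtain ⟨h, h'⟩ := h
      rw [Fin.ext_iff, Fin.val_rev] at h
      rw [Finset.sum_eq_single ((t : ℕ) + 1)]
      · rw [if_pos (by omega)]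
      · intro b _ hb
        rw [if_neg (by omega)]
      · intro hb
        simp only [Finset.mem_Icc] at hb
        omega
    · refine Finset.sum_eq_zero fun i hi => if_neg ?_
      rw [Fin.ext_iff, Fin.val_rev] at h
      simp only [Finset.mem_Icc] at hi
      omega
  rw [Xmat, Matrix.add_apply, hsum, Matrix.smul_apply, Ematrix]
  simp only [Fin.ext_iff, Fin.val_rev, smul_eq_mul]
  split_ifs <;> first | omega | simp

lemma mem_commWith_Xmat {n k : ℕ} (hk : 1 ≤ k) (ε : ℝ) (Y : Matrix (Fin n) (Fin n) ℝ) :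
    Y ∈ commWith n (Xmat n k ε) ↔ ∀ s t : Fin n,
      (if (s : ℕ) < k then (if (s : ℕ) + 1 = k then ε else 1) else 0) * Y s t =
        Y (Fin.rev s) (Fin.rev t) *
          (if (t : ℕ) < k then (if (t : ℕ) + 1 = k then ε else 1) else 0) := by
  change Xmat n k ε * Y = Y * Xmat n k ε ↔ _
  have hrev : ∀ s t : Fin n, s = Fin.rev t ↔ t = Fin.rev s := fun s t => by
    rw [eq_comm, Fin.rev_eq_iff]
  have hl : ∀ s t, (Xmat n k ε * Y) (Fin.rev s) t =
      (if (s : ℕ) < k then (if (s : ℕ) + 1 = k then ε else 1) else 0) * Y s t := by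
    intro s t
    simp [Matrix.mul_apply, Xmat_apply hk]
  have hr : ∀ s t, (Y * Xmat n k ε) s t = Y s (Fin.rev t) *
      (if (t : ℕ) < k then (if (t : ℕ) + 1 = k then ε else 1) else 0) := by
    intro s t
    simp [Matrix.mul_apply, Xmat_apply hk, hrev t]
  constructor
  · intro h s t
    rw [← hl, ← hr, h]
  · intro h
    ext s t
    rw [hr, ← Fin.rev_rev s, hl, h, Fin.rev_rev]

/-- An upper-triangular matrix commutes with `X_{k,ε}` exactly when its first `k` rows and last
`k` columns are diagonal, with the `k` outer pairs of diagonal entries matching. -/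
lemma mem_commWith_Xmat_iff_of_upper {n k : ℕ} (hk : 1 ≤ k) (hkn : 2 * k ≤ n) {ε : ℝ}
    (hε : ε ≠ 0) {Y : Matrix (Fin n) (Fin n) ℝ}
    (hY : ∀ s t : Fin n, (t : ℕ) < (s : ℕ) → Y s t = 0) :
    Y ∈ commWith n (Xmat n k ε) ↔
      (∀ s t : Fin n, (s : ℕ) < k → s ≠ t → Y s t = 0) ∧
      (∀ s t : Fin n, n - k ≤ (t : ℕ) → s ≠ t → Y s t = 0) ∧
      ∀ s : Fin n, (s : ℕ) < k → Y s s = Y (Fin.rev s) (Fin.rev s) := by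
  rw [mem_commWith_Xmat hk]
  have hc : ∀ s : Fin n, (if (s : ℕ) + 1 = k then ε else 1) ≠ 0 := by
    intro s
    split_ifs <;> simp [hε]
  constructor
  · intro h
    refine ⟨fun s t hs hst => ?_, fun s t ht hst => ?_, fun s hs => ?_⟩
    · rcases lt_or_gt_of_ne (Fin.val_ne_of_ne hst) with hlt | hlt
      · have h1 := h s t
        rw [hY (Fin.rev s) (Fin.rev t) (by simp only [Fin.val_rev]; omega), zero_mul,
          if_pos hs] at h1
        exact (mul_eq_zero.mp h1).resolve_left (hc s)
      · exact hY s t hlt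
    · rcases lt_or_gt_of_ne (Fin.val_ne_of_ne hst) with hlt | hlt
      · have h1 := h (Fin.rev s) (Fin.rev t)
        rw [hY (Fin.rev s) (Fin.rev t) (by simp only [Fin.val_rev]; omega), mul_zero,
          Fin.rev_rev, Fin.rev_rev, if_pos (by simp only [Fin.val_rev]; omega)] at h1
        exact (mul_eq_zero.mp h1.symm).resolve_right (hc _)
      · exact hY s t hlt
    · have h1 := h s s
      rw [if_pos hs, mul_comm] at h1
      exact mul_right_cancel₀ (hc s) h1
  · rintro ⟨hrow, hcol, hdiag⟩ s t
    by_cases hst : s = t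
    · subst hst
      by_cases hs : (s : ℕ) < k
      · rw [hdiag s hs, mul_comm]
      · rw [if_neg hs, zero_mul, mul_zero]
    · have hl : (if (s : ℕ) < k then (if (s : ℕ) + 1 = k then ε else 1) else 0) * Y s t = 0 := by
        by_cases hs : (s : ℕ) < k
        · rw [hrow s t hs hst, mul_zero]
        · rw [if_neg hs, zero_mul]
      have hr : Y (Fin.rev s) (Fin.rev t) *
          (if (t : ℕ) < k then (if (t : ℕ) + 1 = k then ε else 1) else 0) = 0 := by
        by_cases ht : (t : ℕ) < k
        · rw [hcol _ _ (by simp only [Fin.val_rev]; omega)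
            (fun h => hst (Fin.rev_injective h)), zero_mul]
        · rw [if_neg ht, mul_zero]
      rw [hl, hr]

/-- The block-diagonal matrix with a diagonal block, an upper-triangular middle block of size
`n - 2k`, and the reversed diagonal block. -/
def symmetricUpperOfEntries (n k : ℕ) :
    (Fin k ⊕ UpperIndex (n - 2 * k) → ℝ) →ₗ[ℝ] Matrix (Fin n) (Fin n) ℝ where
  toFun f := Matrix.of fun s t =>
    if hs : (s : ℕ) < k then (if s = t then f (Sum.inl ⟨s, hs⟩) else 0)
    else if ht : n - k ≤ (t : ℕ) then
      (if s = t then f (Sum.inl ⟨n - (t + 1), by omega⟩) else 0)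
    else if hst : (s : ℕ) ≤ t then
      f (Sum.inr ⟨⟨t - k, by omega⟩, ⟨s - k, by simp only; omega⟩⟩)
    else 0
  map_add' f g := by
    ext s t
    simp only [Matrix.of_apply, Matrix.add_apply, Pi.add_apply]
    split_ifs <;> simp
  map_smul' c f := by
    ext s t
    simp only [Matrix.of_apply, Matrix.smul_apply, Pi.smul_apply, RingHom.id_apply]
    split_ifs <;> simp

lemma symmetricUpperOfEntries_apply (n k : ℕ) (f : Fin k ⊕ UpperIndex (n - 2 * k) → ℝ)
    (s t : Fin n) :
    symmetricUpperOfEntries n k f s t =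
      if hs : (s : ℕ) < k then (if s = t then f (Sum.inl ⟨s, hs⟩) else 0)
      else if ht : n - k ≤ (t : ℕ) then
        (if s = t then f (Sum.inl ⟨n - (t + 1), by omega⟩) else 0)
      else if hst : (s : ℕ) ≤ t then
        f (Sum.inr ⟨⟨t - k, by omega⟩, ⟨s - k, by simp only; omega⟩⟩)
      else 0 := rfl

lemma symmetricUpperOfEntries_injective {n k : ℕ} (hkn : 2 * k ≤ n) :
    Function.Injective (symmetricUpperOfEntries n k) := by
  intro f g h
  ext (i | ⟨j, i⟩)
  · have := congrFun (congrFun h ⟨i, by omega⟩) ⟨i, by omega⟩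
    simpa [symmetricUpperOfEntries_apply] using this
  · have hi := i.2
    have hj := j.2
    have hentry : ∀ f : Fin k ⊕ UpperIndex (n - 2 * k) → ℝ,
        symmetricUpperOfEntries n k f ⟨i + k, by omega⟩ ⟨j + k, by omega⟩ =
          f (Sum.inr ⟨j, i⟩) := by
      intro f
      have hcongr : ∀ (a : Fin (n - 2 * k)) (b : Fin (a + 1)), a = j → (b : ℕ) = i →
          f (Sum.inr ⟨a, b⟩) = f (Sum.inr ⟨j, i⟩) := by
        rintro a b rfl hb
        rw [Fin.ext hb]
      rw [symmetricUpperOfEntries_apply, dif_neg (by simp), dif_neg (by simp only; omega),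
        dif_pos (by simp only; omega)]
      exact hcongr _ _ (Fin.ext (by simp)) (by simp)
    rw [← hentry f, ← hentry g, h]

lemma finrank_borelSl_inf_commWith_add_one {n k : ℕ} (hk : 1 ≤ k) (hkn : 2 * k ≤ n) {ε : ℝ}
    (hε : ε ≠ 0) :
    Module.finrank ℝ ↥(borelSl n ⊓ commWith n (Xmat n k ε)) + 1 =
      k + Fintype.card (UpperIndex (n - 2 * k)) := by
  rw [finrank_add_one_of_parametrization (symmetricUpperOfEntries n k)
    (symmetricUpperOfEntries_injective hkn) ⟨1, ?_⟩, Fintype.card_sum, Fintype.card_fin]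
  · intro Y
    rw [Submodule.mem_inf]
    change (Y.trace = 0 ∧ ∀ s t : Fin n, (t : ℕ) < (s : ℕ) → Y s t = 0) ∧ _ ↔ _
    rw [and_assoc]
    refine and_congr_right fun _ => ⟨?_, ?_⟩
    · rintro ⟨hY, hcomm⟩
      obtain ⟨hrow, hcol, hdiag⟩ := (mem_commWith_Xmat_iff_of_upper hk hkn hε hY).mp hcomm
      refine ⟨Sum.elim (fun i => Y ⟨i, by omega⟩ ⟨i, by omega⟩)
        (fun p => Y ⟨p.2 + k, by omega⟩ ⟨p.1 + k, by omega⟩), ?_⟩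
      ext s t
      rw [symmetricUpperOfEntries_apply]
      split_ifs with hs hst ht hst hst
      · subst hst
        rfl
      · exact (hrow s t hs hst).symm
      · subst hst
        have := hdiag (Fin.rev s) (by simp only [Fin.val_rev]; omega)
        rw [Fin.rev_rev] at this
        exact this
      · exact (hcol s t ht hst).symm
      · simp only [Sum.elim_inr]
        congr 1 <;> simp only [Fin.ext_iff] <;> omega
      · exact (hY s t (by omega)).symm
    · rintro ⟨f, rfl⟩
      have hup : ∀ s t : Fin n, (t : ℕ) < (s : ℕ) → symmetricUpperOfEntries n k f s t = 0 := by
        intro s t hst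
        rw [symmetricUpperOfEntries_apply]
        simp only [Fin.ext_iff]
        split_ifs <;> first | omega | rfl
      refine ⟨hup, (mem_commWith_Xmat_iff_of_upper hk hkn hε hup).mpr ⟨?_, ?_, ?_⟩⟩
      · intro s t hs hst
        rw [symmetricUpperOfEntries_apply, dif_pos hs, if_neg hst]
      · intro s t ht hst
        rw [symmetricUpperOfEntries_apply]
        simp [ht, hst]
      · intro s hs
        rw [symmetricUpperOfEntries_apply, symmetricUpperOfEntries_apply, dif_pos hs,
          dif_neg (by simp only [Fin.val_rev]; omega),
          dif_pos (by simp only [Fin.val_rev]; omega), if_pos rfl, if_pos rfl]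
        congr 2
        simp only [Fin.ext_iff, Fin.val_rev]
        omega
  · have : ∀ s : Fin n, symmetricUpperOfEntries n k 1 s s = 1 := by
      intro s
      simp [symmetricUpperOfEntries_apply]
    simp only [Matrix.trace, Matrix.diag_apply, this]
    simp
    omega

theorem borel_centralizer_dim (n : ℕ) (hn : 4 ≤ n) (k : ℕ) (hk : 2 ≤ k)
    (hkn : 2 * k ≤ n) (ε : ℝ) (hε : ε = 1 ∨ ε = -1) :
    (2 * (Module.finrank ℝ ↥(borelSl n ⊓ commWith n (Xmat n k ε))) : ℤ) =
        ((n : ℤ) - 2 * k - 1) * ((n : ℤ) - 2 * k + 2) + 2 * k ∧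
    (Module.finrank ℝ ↥(borelSl n) : ℤ) -
        (Module.finrank ℝ ↥(borelSl n ⊓ commWith n (Xmat n k ε)) : ℤ) =
      2 * (k : ℤ) * ((n : ℤ) - k) := by
  have hε0 : ε ≠ 0 := by rcases hε with rfl | rfl <;> norm_num
  have hb := finrank_borelSl_add_one (n := n) (by omega)
  have hc := finrank_borelSl_inf_commWith_add_one (by omega : 1 ≤ k) hkn hε0
  have hn' := two_mul_card_upperIndex n
  have hm := two_mul_card_upperIndex (n - 2 * k)
  zify [hkn] at hb hc hn' hm
  constructor
  · linear_combination 2 * hc + hm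
  · have h2 : (2 : ℤ) ≠ 0 := two_ne_zero
    apply mul_left_cancel₀ h2
    linear_combination 2 * hb - 2 * hc + hn' - hm
end

section
/- (Uniqueness of the dense B-orbit.) Let k be an integer with 2 ≤ k and 2k ≤ n and ε ∈ {1,−1}. If Z ∈ O_{k,ε} is such that its B-orbit { b·Z·b⁻¹ : b ∈ B } is dense in O_{k,ε}, then Z lies in the B-orbit of X_{k,ε}, i.e. there exists b ∈ B with Z = b·X_{k,ε}·b⁻¹. Thus B·X_{k,ε} is the unique dense B-orbit contained in O_{k,ε}. -/
open Matrix

/-- The spherical nilpotent orbit `O_{k,ε} = { g·X_{k,ε}·g⁻¹ : g ∈ SL_n(ℝ) }`. -/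
def Orb (n k : ℕ) (ε : ℝ) : Set (Matrix (Fin n) (Fin n) ℝ) :=
  {M | ∃ g : Matrix.SpecialLinearGroup (Fin n) ℝ, g.val * Xmat n k ε * (g⁻¹).val = M}

/-- The `B`-orbit `{ b·X_{k,ε}·b⁻¹ : b ∈ B }`, `B` the upper-triangular Borel subgroup
of `SL_n(ℝ)`. -/
def BOrb (n k : ℕ) (ε : ℝ) : Set (Matrix (Fin n) (Fin n) ℝ) :=
  {M | ∃ b : Matrix.SpecialLinearGroup (Fin n) ℝ,
    (∀ s t : Fin n, (t : ℕ) < (s : ℕ) → b.val s t = 0) ∧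
    b.val * Xmat n k ε * (b⁻¹).val = M}


namespace NilpotentOrbit

variable {n : ℕ}

/-- The vector `x` lies in the span of the first `j` basis vectors. -/
def SuppLT (j : ℕ) (x : Fin n → ℝ) : Prop :=
  ∀ s : Fin n, j ≤ (s : ℕ) → x s = 0

/-- The lower-left `i × i` block of `M` is nonsingular. -/
def CornerNondeg (M : Matrix (Fin n) (Fin n) ℝ) (i : ℕ) : Prop :=
  ∀ x : Fin n → ℝ, SuppLT i x → SuppLT (n - i) (M *ᵥ x) → x = 0

/-- The `s`-th row is the `s`-th row from the bottom of `M` if `s < i`, and the `s`-th row of the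
identity matrix otherwise. -/
def cornerMatrix (M : Matrix (Fin n) (Fin n) ℝ) (i : ℕ) : Matrix (Fin n) (Fin n) ℝ :=
  fun s t => if (s : ℕ) < i then M s.rev t else (1 : Matrix (Fin n) (Fin n) ℝ) s t

/-- The coefficient of `X_{k,ε}` in column `t < k`. -/
def coeff (k : ℕ) (ε : ℝ) (t : ℕ) : ℝ := if t + 1 = k then ε else 1

theorem coeff_mul_self {ε : ℝ} (hε : ε = 1 ∨ ε = -1) (k t : ℕ) :
    coeff k ε t * coeff k ε t = 1 := by
  unfold coeff
  rcases hε with rfl | rfl <;> split_ifs <;> norm_num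

theorem coeff_ne_zero {ε : ℝ} (hε : ε = 1 ∨ ε = -1) (k t : ℕ) : coeff k ε t ≠ 0 :=
  left_ne_zero_of_mul_eq_one (coeff_mul_self hε k t)

theorem suppLT_sub_iff {i : ℕ} {y : Fin n → ℝ} :
    SuppLT (n - i) y ↔ ∀ s : Fin n, (s : ℕ) < i → y s.rev = 0 := by
  constructor
  · intro h s hs
    exact h _ (by rw [Fin.val_rev]; omega)
  · intro h s hs
    have := h s.rev (by rw [Fin.val_rev]; omega)
    rwa [Fin.rev_rev] at this

theorem cornerMatrix_mulVec (M : Matrix (Fin n) (Fin n) ℝ) (i : ℕ) (x : Fin n → ℝ) (s : Fin n) :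
    (cornerMatrix M i *ᵥ x) s = if (s : ℕ) < i then (M *ᵥ x) s.rev else x s := by
  split_ifs with h
  · simp [Matrix.mulVec, dotProduct, cornerMatrix, h]
  · have : (cornerMatrix M i *ᵥ x) s = ((1 : Matrix (Fin n) (Fin n) ℝ) *ᵥ x) s := by
      simp only [Matrix.mulVec, dotProduct, cornerMatrix, h, if_false]
    rw [this, Matrix.one_mulVec]

theorem cornerMatrix_mulVec_eq_zero (M : Matrix (Fin n) (Fin n) ℝ) (i : ℕ) (x : Fin n → ℝ) :
    cornerMatrix M i *ᵥ x = 0 ↔ SuppLT i x ∧ SuppLT (n - i) (M *ᵥ x) := by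
  rw [suppLT_sub_iff, funext_iff]
  simp only [cornerMatrix_mulVec, Pi.zero_apply]
  constructor
  · intro h
    refine ⟨fun s hs => ?_, fun s hs => ?_⟩
    · simpa [Nat.not_lt.2 hs] using h s
    · simpa [hs] using h s
  · rintro ⟨h1, h2⟩ s
    split_ifs with hs
    · exact h2 s hs
    · exact h1 s (Nat.not_lt.1 hs)

theorem cornerNondeg_iff_det_ne_zero (M : Matrix (Fin n) (Fin n) ℝ) (i : ℕ) :
    CornerNondeg M i ↔ (cornerMatrix M i).det ≠ 0 := by
  rw [Ne, ← Matrix.exists_mulVec_eq_zero_iff]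
  simp only [cornerMatrix_mulVec_eq_zero, CornerNondeg]
  constructor
  · rintro h ⟨x, hx, h1, h2⟩
    exact hx (h x h1 h2)
  · intro h x h1 h2
    by_contra hx
    exact h ⟨x, hx, h1, h2⟩

theorem cornerNondeg_iff_surjective (M : Matrix (Fin n) (Fin n) ℝ) (i : ℕ) :
    CornerNondeg M i ↔ Function.Surjective (cornerMatrix M i).mulVec := by
  rw [cornerNondeg_iff_det_ne_zero, Matrix.mulVec_surjective_iff_isUnit,
    Matrix.isUnit_iff_isUnit_det, isUnit_iff_ne_zero]

theorem isOpen_setOf_cornerNondeg (i : ℕ) :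
    IsOpen {M : Matrix (Fin n) (Fin n) ℝ | CornerNondeg M i} := by
  simp only [cornerNondeg_iff_det_ne_zero]
  refine isOpen_ne_fun (Continuous.matrix_det ?_) continuous_const
  refine continuous_matrix fun s t => ?_
  unfold cornerMatrix
  split_ifs
  · exact continuous_id.matrix_elem _ _
  · exact continuous_const

theorem SuppLT.mulVec {b : Matrix (Fin n) (Fin n) ℝ}
    (hb : ∀ s t : Fin n, (t : ℕ) < (s : ℕ) → b s t = 0) {j : ℕ} {x : Fin n → ℝ}
    (hx : SuppLT j x) : SuppLT j (b *ᵥ x) := by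
  intro s hs
  simp only [Matrix.mulVec, dotProduct]
  refine Finset.sum_eq_zero fun t _ => ?_
  rcases lt_or_ge (t : ℕ) s with h | h
  · simp [hb s t h]
  · simp [hx t (hs.trans h)]

theorem CornerNondeg.of_conj {Z : Matrix (Fin n) (Fin n) ℝ}
    {b : Matrix.SpecialLinearGroup (Fin n) ℝ}
    (hb : ∀ s t : Fin n, (t : ℕ) < (s : ℕ) → b.val s t = 0) {i : ℕ}
    (h : CornerNondeg (b.val * Z * (b⁻¹).val) i) : CornerNondeg Z i := by
  have hinv : (b⁻¹).val * b.val = 1 := by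
    rw [← Matrix.SpecialLinearGroup.coe_mul, inv_mul_cancel, Matrix.SpecialLinearGroup.coe_one]
  intro x h1 h2
  have h0 : b.val *ᵥ x = 0 := by
    refine h _ (h1.mulVec hb) ?_
    rw [Matrix.mulVec_mulVec, Matrix.mul_assoc, hinv, Matrix.mul_one, ← Matrix.mulVec_mulVec]
    exact h2.mulVec hb
  rw [← Matrix.one_mulVec x, ← hinv, ← Matrix.mulVec_mulVec, h0, Matrix.mulVec_zero]

theorem Xmat_apply {k : ℕ} (hk : 1 ≤ k) (hkn : k ≤ n) (ε : ℝ) (s t : Fin n) :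
    Xmat n k ε s t = if s = t.rev ∧ (t : ℕ) < k then coeff k ε t else 0 := by
  have hst : s = t.rev ↔ (s : ℕ) + t + 1 = n := by
    rw [Fin.ext_iff, Fin.val_rev]; omega
  have hs := s.isLt
  have ht := t.isLt
  simp only [Xmat, Matrix.add_apply, Matrix.sum_apply, Matrix.smul_apply, smul_eq_mul, Ematrix,
    hst, coeff]
  have hsum : (∑ i ∈ Finset.Icc 1 (k - 1),
      if (s : ℕ) + 1 = n + 1 - i ∧ (t : ℕ) + 1 = i then (1 : ℝ) else 0) =
      if (s : ℕ) + t + 1 = n ∧ (t : ℕ) + 1 < k then 1 else 0 := by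
    by_cases h : (s : ℕ) + t + 1 = n ∧ (t : ℕ) + 1 < k
    · rw [if_pos h, Finset.sum_eq_single ((t : ℕ) + 1)]
      · rw [if_pos]; omega
      · intro i _ hi
        rw [if_neg]; omega
      · intro hi
        rw [Finset.mem_Icc] at hi
        omega
    · rw [if_neg h]
      refine Finset.sum_eq_zero fun i hi => ?_
      rw [Finset.mem_Icc] at hi
      rw [if_neg]; omega
  rw [hsum]
  split_ifs <;> first | omega | simp

theorem Xmat_mulVec {k : ℕ} (hk : 1 ≤ k) (hkn : k ≤ n) (ε : ℝ) (v : Fin n → ℝ) (s : Fin n) :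
    (Xmat n k ε *ᵥ v) s.rev = if (s : ℕ) < k then coeff k ε s * v s else 0 := by
  simp only [Matrix.mulVec, dotProduct, Xmat_apply hk hkn]
  rw [Finset.sum_eq_single s]
  · simp
  · intro t _ hts
    rw [if_neg, zero_mul]
    rintro ⟨h, -⟩
    exact hts (Fin.rev_injective h).symm
  · simp

theorem mul_Xmat_apply {k : ℕ} (hk : 1 ≤ k) (hkn : k ≤ n) (ε : ℝ)
    (b : Matrix (Fin n) (Fin n) ℝ) (s t : Fin n) :
    (b * Xmat n k ε) s t = if (t : ℕ) < k then coeff k ε t * b s t.rev else 0 := by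
  rw [Matrix.mul_apply, Finset.sum_eq_single t.rev]
  · simp [Xmat_apply hk hkn, mul_comm]
  · intro r _ hr
    simp [Xmat_apply hk hkn, hr]
  · simp

theorem Xmat_mul_self {k : ℕ} (hk : 1 ≤ k) (hkn : 2 * k ≤ n) (ε : ℝ) :
    Xmat n k ε * Xmat n k ε = 0 := by
  ext s t
  rw [mul_Xmat_apply hk (by omega), Xmat_apply hk (by omega)]
  split_ifs with h1 h2
  · rw [Fin.val_rev] at h2
    omega
  all_goals simp

theorem cornerNondeg_Xmat {k : ℕ} (hk : 1 ≤ k) (hkn : k ≤ n) {ε : ℝ} (hε : ε = 1 ∨ ε = -1)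
    {i : ℕ} (hi : i ≤ k) : CornerNondeg (Xmat n k ε) i := by
  intro x h1 h2
  rw [suppLT_sub_iff] at h2
  ext s
  by_cases hs : (s : ℕ) < i
  · have := h2 s hs
    rw [Xmat_mulVec hk hkn, if_pos (by omega)] at this
    exact (mul_eq_zero.1 this).resolve_left (coeff_ne_zero hε _ _)
  · exact h1 s (Nat.not_lt.1 hs)

/-- Vectors in the range of a conjugate of `X_{k,ε}` with nonsingular lower-left `k × k` block are
determined by their last `k` entries. -/
theorem mulVec_eq_zero_of_suppLT {k : ℕ} (hk : 1 ≤ k) (hkn : k ≤ n) {ε : ℝ}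
    {Z g g' : Matrix (Fin n) (Fin n) ℝ} (hgg' : g * g' = 1) (hZg : Z * g = g * Xmat n k ε)
    (hZ : CornerNondeg Z k) {x : Fin n → ℝ} (hx : SuppLT (n - k) (Z *ᵥ x)) : Z *ᵥ x = 0 := by
  have htrunc (v w : Fin n → ℝ) (hvw : ∀ s : Fin n, (s : ℕ) < k → v s = w s) :
      (Z * g) *ᵥ v = (Z * g) *ᵥ w := by
    rw [hZg, ← Matrix.mulVec_mulVec, ← Matrix.mulVec_mulVec]
    congr 1
    ext s
    rw [← Fin.rev_rev s, Xmat_mulVec hk hkn, Xmat_mulVec hk hkn]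
    split_ifs with h
    · rw [hvw _ h]
    · rfl
  have hZx (v : Fin n → ℝ) : (Z * g) *ᵥ (g' *ᵥ v) = Z *ᵥ v := by
    rw [Matrix.mulVec_mulVec, Matrix.mul_assoc, hgg', Matrix.mul_one]
  have hnd : CornerNondeg (Z * g) k := by
    rw [cornerNondeg_iff_surjective] at hZ ⊢
    intro w
    obtain ⟨u, hu⟩ := hZ w
    refine ⟨fun s => if (s : ℕ) < k then (g' *ᵥ u) s else w s, ?_⟩
    ext s
    rw [cornerMatrix_mulVec]
    split_ifs with hs
    · rw [htrunc _ (g' *ᵥ u) fun s hs => if_pos hs, hZx, ← hu, cornerMatrix_mulVec, if_pos hs]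
    · rfl
  have htr := htrunc (fun s => if (s : ℕ) < k then (g' *ᵥ x) s else 0) (g' *ᵥ x)
    fun s hs => if_pos hs
  rw [hZx] at htr
  rw [← htr, hnd _ (fun s hs => if_neg (Nat.not_lt.2 hs)) (by rwa [htr]), Matrix.mulVec_zero]

/-- The leading `k` columns of the conjugating upper-triangular matrix. -/
theorem exists_leading_column {Z : Matrix (Fin n) (Fin n) ℝ} {k : ℕ}
    (hZ : ∀ i ≤ k, CornerNondeg Z i) (t : Fin n) (ht : (t : ℕ) < k) :
    ∃ x : Fin n → ℝ, SuppLT (t + 1) x ∧ x t ≠ 0 ∧ SuppLT (n - t) (Z *ᵥ x) ∧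
      (Z *ᵥ x) t.rev ≠ 0 := by
  obtain ⟨x, hx⟩ := (cornerNondeg_iff_surjective Z _).1 (hZ (t + 1) ht) (Pi.single t 1)
  rw [funext_iff] at hx
  simp only [cornerMatrix_mulVec] at hx
  have hsupp : SuppLT (t + 1) x := fun s hs => by
    have := hx s
    rwa [if_neg (by omega), Pi.single_eq_of_ne (by rintro rfl; omega)] at this
  have hZx : SuppLT (n - t) (Z *ᵥ x) := suppLT_sub_iff.2 fun s hs => by
    have := hx s
    rwa [if_pos (by omega), Pi.single_eq_of_ne (by rintro rfl; omega)] at this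
  have hlead : (Z *ᵥ x) t.rev = 1 := by simpa using hx t
  refine ⟨x, hsupp, fun h0 => ?_, hZx, by simp [hlead]⟩
  have hx0 : x = 0 := hZ t ht.le x (fun s hs => by
    rcases hs.eq_or_lt with h | h
    · rwa [← Fin.ext h]
    · exact hsupp s h) hZx
  simp [hx0] at hlead

/-- The middle columns of the conjugating upper-triangular matrix. -/
theorem exists_middle_column {k : ℕ} (hk : 1 ≤ k) (hkn : k ≤ n) {ε : ℝ}
    {Z g g' : Matrix (Fin n) (Fin n) ℝ} (hgg' : g * g' = 1) (hZg : Z * g = g * Xmat n k ε)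
    (hZ : CornerNondeg Z k) (t : Fin n) (ht : k ≤ (t : ℕ)) :
    ∃ x : Fin n → ℝ, SuppLT (t + 1) x ∧ x t ≠ 0 ∧ Z *ᵥ x = 0 := by
  obtain ⟨y, hy⟩ := (cornerNondeg_iff_surjective Z k).1 hZ
    fun s => if (s : ℕ) < k then (Z *ᵥ Pi.single t 1) s.rev else 0
  rw [funext_iff] at hy
  simp only [cornerMatrix_mulVec] at hy
  have hys : SuppLT k y := fun s hs => by simpa [Nat.not_lt.2 hs] using hy s
  refine ⟨Pi.single t 1 - y, fun s hs => ?_, ?_, ?_⟩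
  · rw [Pi.sub_apply, hys s (by omega), Pi.single_eq_of_ne (by rintro rfl; omega), sub_zero]
  · simp [hys t ht]
  · refine mulVec_eq_zero_of_suppLT hk hkn hgg' hZg hZ (suppLT_sub_iff.2 fun s hs => ?_)
    have := hy s
    rw [if_pos hs, if_pos hs] at this
    rw [Matrix.mulVec_sub, Pi.sub_apply, this, sub_self]

theorem exists_upperTriangular_mul_Xmat {k : ℕ} (hk : 1 ≤ k) (hkn : 2 * k ≤ n) {ε : ℝ}
    (hε : ε = 1 ∨ ε = -1) {Z g g' : Matrix (Fin n) (Fin n) ℝ} (hgg' : g * g' = 1)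
    (hZg : Z * g = g * Xmat n k ε) (hZ : ∀ i ≤ k, CornerNondeg Z i) :
    ∃ b : Matrix (Fin n) (Fin n) ℝ, (∀ s t : Fin n, (t : ℕ) < (s : ℕ) → b s t = 0) ∧
      b.det ≠ 0 ∧ Z * b = b * Xmat n k ε := by
  have hkn' : k ≤ n := by omega
  have hZZ : Z * Z = 0 := by
    have : Z * Z * g = 0 := by
      rw [Matrix.mul_assoc, hZg, ← Matrix.mul_assoc, hZg, Matrix.mul_assoc,
        Xmat_mul_self hk hkn, Matrix.mul_zero]
    rw [← Matrix.mul_one (Z * Z), ← hgg', ← Matrix.mul_assoc, this, Matrix.zero_mul]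
  choose! u hu_supp hu_diag hu_img hu_lead using exists_leading_column hZ
  choose! m hm_supp hm_diag hm_ker using
    exists_middle_column hk hkn' hgg' hZg (hZ k le_rfl)
  let c : Fin n → Fin n → ℝ := fun t =>
    if (t : ℕ) < k then u t
    else if (t.rev : ℕ) < k then coeff k ε t.rev • (Z *ᵥ u t.rev)
    else m t
  have hc_supp (t : Fin n) : SuppLT (t + 1) (c t) := by
    simp only [c]
    split_ifs with h1 h2
    · exact hu_supp t h1
    · intro s hs
      rw [Pi.smul_apply, hu_img t.rev h2 s (by rw [Fin.val_rev]; omega), smul_zero]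
    · exact hm_supp t (by omega)
  have hc_diag (t : Fin n) : c t t ≠ 0 := by
    simp only [c]
    split_ifs with h1 h2
    · exact hu_diag t h1
    · have := hu_lead t.rev h2
      rw [Fin.rev_rev] at this
      exact mul_ne_zero (coeff_ne_zero hε _ _) this
    · exact hm_diag t (by omega)
  have hc_mul (t : Fin n) :
      Z *ᵥ c t = if (t : ℕ) < k then coeff k ε t • c t.rev else 0 := by
    by_cases h1 : (t : ℕ) < k
    · have h2 : ¬ ((t.rev : Fin n) : ℕ) < k := by rw [Fin.val_rev]; omega
      simp only [c, if_pos h1, if_neg h2, Fin.rev_rev]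
      rw [smul_smul, coeff_mul_self hε, one_smul]
    · rw [if_neg h1]
      simp only [c, if_neg h1]
      split_ifs with h2
      · rw [Matrix.mulVec_smul, Matrix.mulVec_mulVec, hZZ, Matrix.zero_mulVec, smul_zero]
      · exact hm_ker t (by omega)
  have hupper : ∀ s t : Fin n, (t : ℕ) < (s : ℕ) → c t s = 0 := fun s t hst => hc_supp t s hst
  refine ⟨Matrix.of fun s t => c t s, hupper, ?_, ?_⟩
  · have htri : (Matrix.of fun s t => c t s).IsUpperTriangular := fun s t hst => hupper s t hst
    rw [Matrix.det_of_isUpperTriangular htri]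
    exact Finset.prod_ne_zero_iff.2 fun t _ => hc_diag t
  · ext s t
    rw [mul_Xmat_apply hk hkn']
    change (Z *ᵥ c t) s = _
    rw [hc_mul]
    split_ifs <;> rfl

/-- For `n = 2k` the centralizer of `X_{k,ε}` in `GL_n(ℝ)` has nonnegative determinants. -/
theorem det_nonneg_of_commute {k : ℕ} (hk : 1 ≤ k) {ε : ℝ} (hε : ε = 1 ∨ ε = -1)
    (hn : n = k + k) {h : Matrix (Fin n) (Fin n) ℝ} (hcomm : h * Xmat n k ε = Xmat n k ε * h) :
    0 ≤ h.det := by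
  subst hn
  let e : Fin k ⊕ Fin k ≃ Fin (k + k) := finSumFinEquiv
  let J : Matrix (Fin k) (Fin k) ℝ :=
    Matrix.of fun s t => if s = t.rev then coeff k ε t else 0
  have hX : (Xmat (k + k) k ε).submatrix e e = Matrix.fromBlocks 0 0 J 0 := by
    ext (s | s) (t | t)
    all_goals
      have hs := s.isLt
      have ht := t.isLt
      simp [Xmat_apply hk (Nat.le_add_left k k), e, J, Fin.ext_iff]
      try first | (intros; omega) | (split_ifs <;> first | rfl | omega)
  have hJJ : J * Jᵀ = 1 := by
    ext s t
    rw [Matrix.mul_apply, Finset.sum_eq_single s.rev]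
    · by_cases hst : t = s
      · subst hst
        simp [J, coeff_mul_self hε]
      · simp [J, hst, Ne.symm hst]
    · intro r _ hr
      have : s ≠ r.rev := by
        rintro rfl
        simp at hr
      simp [J, this]
    · simp
  have hJ : J.det ≠ 0 := by
    intro h0
    have := congrArg Matrix.det hJJ
    simp [h0] at this
  obtain ⟨A, B, C, D, hH⟩ : ∃ A B C D, h.submatrix e e = Matrix.fromBlocks A B C D :=
    ⟨_, _, _, _, (Matrix.fromBlocks_toBlocks _).symm⟩
  have hcomm' := congrArg (fun M => M.submatrix e e) hcomm
  simp only [← Matrix.submatrix_mul_equiv _ _ e e e, hX, hH, Matrix.fromBlocks_multiply,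
    Matrix.zero_mul, Matrix.mul_zero, add_zero, zero_add, Matrix.fromBlocks_inj] at hcomm'
  obtain ⟨hBJ, -, hDJ, -⟩ := hcomm'
  have hB : B = 0 := by
    rw [← Matrix.mul_one B, ← hJJ, ← Matrix.mul_assoc, hBJ, Matrix.zero_mul]
  have hAD : D.det = A.det := by
    have := congrArg Matrix.det hDJ
    rw [Matrix.det_mul, Matrix.det_mul, mul_comm] at this
    exact mul_left_cancel₀ hJ this
  rw [← Matrix.det_submatrix_equiv_self e, hH, hB, Matrix.det_fromBlocks_zero₁₂, hAD]
  exact mul_self_nonneg _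

theorem exists_upperTriangular_det_pos {k : ℕ} (hk : 1 ≤ k) (hkn : 2 * k ≤ n) {ε : ℝ}
    (hε : ε = 1 ∨ ε = -1) {Z g g' : Matrix (Fin n) (Fin n) ℝ} (hgg' : g * g' = 1)
    (hdet : g.det = 1) (hZg : Z * g = g * Xmat n k ε) (hZ : ∀ i ≤ k, CornerNondeg Z i) :
    ∃ b : Matrix (Fin n) (Fin n) ℝ, (∀ s t : Fin n, (t : ℕ) < (s : ℕ) → b s t = 0) ∧
      0 < b.det ∧ Z * b = b * Xmat n k ε := by
  obtain ⟨b, hb, hb0, hZb⟩ := exists_upperTriangular_mul_Xmat hk hkn hε hgg' hZg hZ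
  rcases lt_or_gt_of_ne hb0 with hneg | hpos
  · rcases hkn.eq_or_lt with heq | hlt
    · exfalso
      have hg'g : g' * g = 1 := mul_eq_one_comm.1 hgg'
      have hdet' : g'.det = 1 := by
        have := congrArg Matrix.det hgg'
        rwa [Matrix.det_mul, hdet, one_mul, Matrix.det_one] at this
      have hg'Z : g' * Z = Xmat n k ε * g' := by
        rw [← Matrix.mul_one (g' * Z), ← hgg', ← Matrix.mul_assoc, Matrix.mul_assoc g', hZg,
          ← Matrix.mul_assoc, hg'g, Matrix.one_mul]
      have hcomm : (g' * b) * Xmat n k ε = Xmat n k ε * (g' * b) := by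
        rw [Matrix.mul_assoc, ← hZb, ← Matrix.mul_assoc, hg'Z, Matrix.mul_assoc]
      have := det_nonneg_of_commute hk hε (by omega) hcomm
      rw [Matrix.det_mul, hdet', one_mul] at this
      linarith
    · let p : Fin n := ⟨k, by omega⟩
      let d : Fin n → ℝ := Function.update 1 p (-1)
      have hd (t : Fin n) (ht : (t : ℕ) ≠ k) : d t = 1 := by
        simp [d, Function.update_of_ne (show t ≠ p from fun h => ht (by simp [h, p]))]
      refine ⟨b * Matrix.diagonal d, fun s t hst => ?_, ?_, ?_⟩
      · rw [Matrix.mul_diagonal, hb s t hst, zero_mul]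
      · have : ∏ t, d t = -1 := by
          simp [d, Finset.prod_update_of_mem]
        rw [Matrix.det_mul, Matrix.det_diagonal, this]
        linarith
      · ext s t
        rw [← Matrix.mul_assoc, hZb, Matrix.mul_diagonal, mul_Xmat_apply hk (by omega),
          mul_Xmat_apply hk (by omega)]
        split_ifs with ht
        · rw [Matrix.mul_diagonal, hd t (by omega), hd t.rev (by rw [Fin.val_rev]; omega),
            mul_one, mul_one]
        · rw [zero_mul]
  · exact ⟨b, hb, hpos, hZb⟩

end NilpotentOrbit

open NilpotentOrbit

theorem dense_BOrbit_unique (n : ℕ) (hn : 4 ≤ n) (k : ℕ) (hk : 2 ≤ k)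
    (hkn : 2 * k ≤ n) (ε : ℝ) (hε : ε = 1 ∨ ε = -1)
    (Z : Matrix (Fin n) (Fin n) ℝ) (hZ : Z ∈ Orb n k ε)
    (hdense : ∀ M ∈ Orb n k ε,
      M ∈ closure {W | ∃ b : Matrix.SpecialLinearGroup (Fin n) ℝ,
        (∀ s t : Fin n, (t : ℕ) < (s : ℕ) → b.val s t = 0) ∧
        b.val * Z * (b⁻¹).val = W}) :
    ∃ b : Matrix.SpecialLinearGroup (Fin n) ℝ,
      (∀ s t : Fin n, (t : ℕ) < (s : ℕ) → b.val s t = 0) ∧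
      Z = b.val * Xmat n k ε * (b⁻¹).val := by
  have hk1 : 1 ≤ k := by omega
  have hnd : ∀ i ≤ k, CornerNondeg Z i := fun i hi => by
    have hX : Xmat n k ε ∈ Orb n k ε := ⟨1, by simp⟩
    obtain ⟨W, hW, b, hb, rfl⟩ := mem_closure_iff.1 (hdense _ hX) _
      (isOpen_setOf_cornerNondeg i) (cornerNondeg_Xmat hk1 (by omega) hε hi)
    exact CornerNondeg.of_conj hb hW
  obtain ⟨g, hg⟩ := hZ
  have hginv : (g⁻¹).val * g.val = 1 := by
    rw [← Matrix.SpecialLinearGroup.coe_mul, inv_mul_cancel, Matrix.SpecialLinearGroup.coe_one]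
  have hZg : Z * g.val = g.val * Xmat n k ε := by
    rw [← hg, Matrix.mul_assoc, hginv, Matrix.mul_one]
  obtain ⟨b, hb, hpos, hZb⟩ := exists_upperTriangular_det_pos hk1 hkn hε
    (mul_eq_one_comm.1 hginv) g.prop hZg hnd
  let r : ℝ := b.det ^ ((n : ℝ)⁻¹)
  have hr : r ^ n = b.det := Real.rpow_inv_natCast_pow hpos.le (by omega)
  let β : Matrix.SpecialLinearGroup (Fin n) ℝ := ⟨r⁻¹ • b, by
    rw [Matrix.det_smul, Fintype.card_fin, inv_pow, hr, inv_mul_cancel₀ hpos.ne']⟩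
  have hβ : β.val * (β⁻¹).val = 1 := by
    rw [← Matrix.SpecialLinearGroup.coe_mul, mul_inv_cancel, Matrix.SpecialLinearGroup.coe_one]
  refine ⟨β, fun s t hst => ?_, ?_⟩
  · simp [β, hb s t hst]
  · have hZβ : Z * β.val = β.val * Xmat n k ε := by
      simp only [β, Matrix.mul_smul, Matrix.smul_mul, hZb]
    rw [← hZβ, Matrix.mul_assoc, hβ, Matrix.mul_one]
end
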